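/- Let D be a Prüfer domain that is N-2. Then for every prime ideal 𝔭 of D, both the localization D_𝔭 and the quotient domain D/𝔭 are N-2. -/

import Mathlib

set_option synthInstance.maxHeartbeats 400000
set_option maxHeartbeats 800000

universe u

/-- An integral domain `S` is N-1 if the integral closure of `S` in its fraction
field is a finitely generated `S`-module. -/
def IsN1 (S : Type u) [CommRing S] [IsDomain S] : Prop :=
  Module.Finite S (integralClosure S (FractionRing S))

/-- An integral domain `S` is N-2 (Japanese) if for every finite field extension `L`
of its fraction field, the integral closure of `S` in `L` is a finitely generated
`S`-module. -/
def IsN2 (S : Type u) [CommRing S] [IsDomain S] : Prop :=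
  ∀ (L : Type u) [Field L] [Algebra S L] [Algebra (FractionRing S) L]
    [IsScalarTower S (FractionRing S) L],
    FiniteDimensional (FractionRing S) L → Module.Finite S (integralClosure S L)

/-- A commutative ring `R` is universally Japanese if every finite type `R`-algebra
that is an integral domain is N-1. -/
def UniversallyJapanese (R : Type u) [CommRing R] : Prop :=
  ∀ (A : Type u) [CommRing A] [IsDomain A] [Algebra R A],
    Algebra.FiniteType R A → IsN1 A

/-- A Prüfer domain is an integral domain whose localization at every prime ideal
is a valuation ring. -/
def IsPruferDomain (D : Type u) [CommRing D] [IsDomain D] : Prop :=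
  ∀ (P : Ideal D) [P.IsPrime], ValuationRing (Localization.AtPrime P)

open Polynomial

/-- Any two elements are comparable for divisibility in the localization at every prime,
phrased without localizations. -/
def IsLocallyDvdTotal (A : Type*) [CommRing A] : Prop :=
  ∀ (P : Ideal A), P.IsPrime → ∀ a b : A, ∃ s ∉ P, b ∣ s * a ∨ a ∣ s * b

theorem IsPruferDomain.isLocallyDvdTotal {D : Type u} [CommRing D] [IsDomain D]
    (hD : IsPruferDomain D) : IsLocallyDvdTotal D := by
  intro P hP a b
  have := hD P
  have key : ∀ a b : D, algebraMap D (Localization.AtPrime P) b ∣ algebraMap D _ a →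
      ∃ s ∉ P, b ∣ s * a := by
    rintro a b ⟨c, hc⟩
    obtain ⟨⟨d, s⟩, hs⟩ := IsLocalization.surj P.primeCompl c
    refine ⟨s, s.2, d, ?_⟩
    apply IsLocalization.injective (Localization.AtPrime P) P.primeCompl_le_nonZeroDivisors
    rw [map_mul, map_mul, hc, ← hs]
    ring
  rcases ValuationRing.dvd_total (algebraMap D (Localization.AtPrime P) b)
    (algebraMap D _ a) with h | h
  · obtain ⟨s, hs, h⟩ := key _ _ h
    exact ⟨s, hs, .inl h⟩
  · obtain ⟨s, hs, h⟩ := key _ _ h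
    exact ⟨s, hs, .inr h⟩

theorem IsLocallyDvdTotal.of_surjective {R A : Type*} [CommRing R] [CommRing A]
    (h : IsLocallyDvdTotal R) (f : R →+* A) (hf : Function.Surjective f) :
    IsLocallyDvdTotal A := by
  intro P hP a b
  obtain ⟨a, rfl⟩ := hf a
  obtain ⟨b, rfl⟩ := hf b
  obtain ⟨s, hs, h⟩ := h (P.comap f) inferInstance a b
  refine ⟨f s, hs, ?_⟩
  rw [← map_mul, ← map_mul]
  exact h.imp (map_dvd f) (map_dvd f)

theorem Finset.exists_smul_dominating {A N : Type*} [CommRing A] [AddCommGroup N] [Module A N]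
    (P : Ideal A) [P.IsPrime]
    (h : ∀ x y : N, ∃ s ∉ P, (∃ c : A, s • x = c • y) ∨ ∃ c : A, s • y = c • x)
    (t : Finset N) (ht : t.Nonempty) :
    ∃ i ∈ t, ∃ s ∉ P, ∀ j ∈ t, ∃ c : A, s • j = c • i := by
  induction ht using Finset.Nonempty.cons_induction with
  | singleton a => exact ⟨a, by simp, 1, P.one_notMem, by simpa using ⟨1, (one_smul A a).symm⟩⟩
  | cons a t ha ht ih =>
    obtain ⟨i, hi, s, hs, hst⟩ := ih
    obtain ⟨u, hu, ⟨c, hc⟩ | ⟨c, hc⟩⟩ := h a i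
    · refine ⟨i, Finset.mem_cons_of_mem hi, s * u, Ideal.IsPrime.mul_notMem ‹_› hs hu, ?_⟩
      intro j hj
      rcases Finset.mem_cons.1 hj with rfl | hj
      · exact ⟨s * c, by rw [mul_smul, hc, mul_smul]⟩
      · obtain ⟨d, hd⟩ := hst j hj
        exact ⟨u * d, by rw [mul_comm, mul_smul, hd, mul_smul]⟩
    · refine ⟨a, Finset.mem_cons_self a t, s * u, Ideal.IsPrime.mul_notMem ‹_› hs hu, ?_⟩
      intro j hj
      rcases Finset.mem_cons.1 hj with rfl | hj
      · exact ⟨_, rfl⟩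
      · obtain ⟨d, hd⟩ := hst j hj
        exact ⟨d * c, by rw [mul_comm, mul_smul, hd, smul_comm, hc, mul_smul]⟩

/-- If `A` is integrally closed in the field `L` and `y` is a root of a polynomial with some
coefficient outside of the prime `Q`, then `y` or `y⁻¹` lies in the localization of `A` at `Q`. -/
theorem exists_mul_eq_of_aeval_eq_zero {A L : Type*} [CommRing A] [Field L] [Algebra A L]
    [IsIntegrallyClosedIn A L] [FaithfulSMul A L] (Q : Ideal A) [Q.IsPrime] (y : L) (n : ℕ)
    (p : A[X]) (hn : p.natDegree ≤ n) (hp : aeval y p = 0) (hQ : ∃ i, p.coeff i ∉ Q) :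
    ∃ s ∉ Q, ∃ c : A, algebraMap A L s * y = algebraMap A L c ∨
      algebraMap A L s = algebraMap A L c * y := by
  induction n generalizing p with
  | zero =>
    exfalso
    obtain ⟨i, hi⟩ := hQ
    rw [eq_C_of_natDegree_le_zero hn, aeval_C,
      FaithfulSMul.algebraMap_eq_zero_iff] at hp
    rw [eq_C_of_natDegree_le_zero hn, hp] at hi
    simp at hi
  | succ n ih =>
    by_cases hd : p.natDegree ≤ n
    · exact ih p hd hp hQ
    have hd : p.natDegree = n + 1 := by omega
    obtain ⟨c, hc⟩ := IsIntegrallyClosedIn.algebraMap_eq_of_integral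
      (isIntegral_leadingCoeff_smul p y hp)
    rw [Algebra.smul_def] at hc
    by_cases h1 : p.leadingCoeff ∈ Q
    swap
    · exact ⟨_, h1, c, .inl hc.symm⟩
    by_cases h2 : c ∈ Q
    swap
    · exact ⟨c, h2, _, .inr hc⟩
    refine ih (p.eraseLead + C c * X ^ n) ?_ ?_ ?_
    · refine natDegree_add_le_of_degree_le ?_ (natDegree_C_mul_X_pow_le _ _)
      exact (eraseLead_natDegree_le p).trans (by omega)
    · rw [← self_sub_monomial_natDegree_leadingCoeff]
      simp [hp, hc, hd, aeval_monomial, pow_succ']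
      ring
    · obtain ⟨i, hi⟩ := hQ
      refine ⟨i, ?_⟩
      have hin : i ≠ p.natDegree := by rintro rfl; exact hi h1
      rw [coeff_add, eraseLead_coeff_of_ne i hin, coeff_C_mul_X_pow]
      split_ifs
      · rwa [Ideal.add_mem_iff_left _ h2]
      · simpa using hi

theorem IsLocallyDvdTotal.integralClosure_of_isAlgebraic {A L : Type*} [CommRing A] [Field L]
    [Algebra A L] [FaithfulSMul A L] [Algebra.IsAlgebraic A L] (h : IsLocallyDvdTotal A) :
    IsLocallyDvdTotal (integralClosure A L) := by
  intro Q hQ a b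
  by_cases hb : b = 0
  · exact ⟨1, Q.one_notMem, .inr (by simp [hb])⟩
  have hb' : (b : L) ≠ 0 := by simpa using hb
  obtain ⟨p, hp0, hp⟩ := Algebra.IsAlgebraic.isAlgebraic (R := A) ((a : L) / b)
  have : IsDomain A := (FaithfulSMul.algebraMap_injective A L).isDomain
  let P : Ideal A := Q.comap (algebraMap A _)
  obtain ⟨x, hx, s, hs, hc⟩ := Finset.exists_smul_dominating P
    (fun x y ↦ by
      obtain ⟨s, hs, ⟨c, hc⟩ | ⟨c, hc⟩⟩ := h P inferInstance x y
      · exact ⟨s, hs, .inl ⟨c, by simpa [mul_comm] using hc⟩⟩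
      · exact ⟨s, hs, .inr ⟨c, by simpa [mul_comm] using hc⟩⟩) p.coeffs
    (by rwa [Finset.nonempty_iff_ne_empty, Ne, coeffs_empty_iff])
  obtain ⟨i, hi, rfl⟩ := mem_coeffs_iff.1 hx
  have hc' : ∀ j, ∃ c : A, s * p.coeff j = p.coeff i * c := by
    intro j
    by_cases hj : p.coeff j = 0
    · exact ⟨0, by simp [hj]⟩
    · obtain ⟨c, hc⟩ := hc _ (coeff_mem_coeffs hj)
      exact ⟨c, by simpa [mul_comm] using hc⟩
  choose c hc' using hc'
  have hi0 : p.coeff i ≠ 0 := mem_support_iff.1 hi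
  let q : A[X] := ∑ j ∈ Finset.range (p.natDegree + 1), monomial j (c j)
  have hqp : C s * p = C (p.coeff i) * q := by
    conv_lhs => rw [p.as_sum_range]
    simp only [q, Finset.mul_sum, C_mul_monomial, hc']
  have hq : aeval ((a : L) / b) q = 0 := by
    have := congrArg (aeval ((a : L) / b)) hqp
    simpa [hp, hi0] using this.symm
  have hqi : q.coeff i = s := by
    have := congrArg (fun r ↦ r.coeff i) hqp
    simp only [coeff_C_mul] at this
    exact mul_left_cancel₀ hi0 (by rw [← this, mul_comm])
  obtain ⟨t, ht, d, hd⟩ := exists_mul_eq_of_aeval_eq_zero Q ((a : L) / b) _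
    (q.map (algebraMap A (integralClosure A L))) le_rfl (by simpa using hq)
    ⟨i, by rw [coeff_map, hqi]; exact hs⟩
  refine ⟨t, ht, hd.imp (fun hd ↦ ⟨d, ?_⟩) (fun hd ↦ ⟨d, ?_⟩)⟩
  · apply Subtype.ext
    change (t : L) * a = b * d
    change (t : L) * (a / b) = d at hd
    rw [← hd]
    field_simp
  · apply Subtype.ext
    change (t : L) * b = a * d
    change (t : L) = d * (a / b) at hd
    rw [hd]
    field_simp

theorem IsLocallyDvdTotal.isIntegral_mem_range {A F : Type*} [CommRing A] [Field F] [Algebra A F]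
    (h : IsLocallyDvdTotal A) {x : F} (hx : IsIntegral A x) {a b : A}
    (hb : algebraMap A F b ≠ 0) (hab : algebraMap A F b * x = algebraMap A F a) :
    ∃ c, algebraMap A F c = x := by
  let I : Ideal A := (⊥ : Subalgebra A F).toSubmodule.comap (LinearMap.toSpanSingleton A F x)
  have hI : ∀ c : A, c ∈ I ↔ ∃ d, algebraMap A F d = algebraMap A F c * x := by
    intro c
    simp [I, Algebra.mem_bot, Algebra.smul_def]
  by_cases htop : I = ⊤
  · obtain ⟨d, hd⟩ := (hI 1).1 (htop ▸ Submodule.mem_top)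
    exact ⟨d, by simpa using hd⟩
  exfalso
  obtain ⟨m, hm, hIm⟩ := Ideal.exists_le_maximal I htop
  obtain ⟨s, hs, hc⟩ := h m hm.isPrime a b
  suffices ∃ n, s ^ n ∈ I by
    obtain ⟨n, hn⟩ := this
    exact hs (hm.isPrime.mem_of_pow_mem n (hIm hn))
  rcases hc with ⟨c, hc⟩ | ⟨c, hc⟩
  · refine ⟨1, (hI _).2 ⟨c, mul_left_cancel₀ hb ?_⟩⟩
    rw [← map_mul, ← hc, pow_one, map_mul, ← hab]
    ring
  · have hsx : algebraMap A F s = algebraMap A F c * x := by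
      apply mul_left_cancel₀ hb
      rw [← map_mul, mul_comm, hc, map_mul, ← hab]
      ring
    obtain ⟨p, hp, hpx⟩ := hx
    have hn : p.natDegree ≠ 0 := by
      intro h0
      rw [hp.natDegree_eq_zero.1 h0] at hpx
      simp at hpx
    obtain ⟨n, hn⟩ := Nat.exists_eq_succ_of_ne_zero hn
    refine ⟨n, (hI _).2 ⟨-∑ i ∈ Finset.range (n + 1), p.coeff i * c ^ (n - i) * s ^ i, ?_⟩⟩
    have hx' : x ^ (n + 1) = -∑ i ∈ Finset.range (n + 1), algebraMap A F (p.coeff i) * x ^ i := by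
      rw [eval₂_eq_sum_range, hn, Finset.sum_range_succ] at hpx
      rw [eq_neg_iff_add_eq_zero, ← hpx, ← Nat.succ_eq_add_one, ← hn, hp.coeff_natDegree]
      simp [add_comm]
    calc _ = -∑ i ∈ Finset.range (n + 1), algebraMap A F c ^ n *
            (algebraMap A F (p.coeff i) * x ^ i) := by
          simp only [map_neg, map_sum, map_mul, map_pow, hsx]
          congr 1
          refine Finset.sum_congr rfl fun i hi ↦ ?_
          obtain ⟨k, rfl⟩ := Nat.exists_eq_add_of_le (Finset.mem_range_succ_iff.1 hi)
          rw [Nat.add_sub_cancel_left]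
          ring
      _ = _ := by
          rw [← Finset.mul_sum, ← mul_neg, ← hx', map_pow, hsx]
          ring

theorem IsLocallyDvdTotal.projective_of_fg {A k : Type*} [CommRing A] [IsDomain A] [Field k]
    [Algebra A k] [IsFractionRing A k] (h : IsLocallyDvdTotal A) {I : Submodule A k}
    (hI : I.FG) : Module.Projective A I := by
  by_cases hI0 : I = ⊥
  · subst hI0
    infer_instance
  obtain ⟨t, rfl⟩ := hI
  apply Submodule.projective_of_isUnit
  refine IsUnit.of_mul_eq_one (1 / Submodule.span A (t : Set k))
    (le_antisymm Submodule.mul_one_div_le_one ?_)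
  set I := Submodule.span A (t : Set k) with hIdef
  let J : Ideal A := (I * (1 / I)).comap (Algebra.linearMap A k)
  suffices J = ⊤ by
    rw [Submodule.one_le]
    simpa [J] using (Ideal.eq_top_iff_one _).1 this
  by_contra hJ
  obtain ⟨m, hm, hJm⟩ := Ideal.exists_le_maximal J hJ
  have hmp := hm.isPrime
  obtain ⟨x, hx, s, hs, hc⟩ := Finset.exists_smul_dominating (N := k) m
    (fun x y ↦ by
      obtain ⟨a, b, d, rfl, rfl⟩ : ∃ a b d : A, x = algebraMap A k a / algebraMap A k d ∧
          y = algebraMap A k b / algebraMap A k d := by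
        obtain ⟨a, d, hd, rfl⟩ := IsFractionRing.div_surjective (A := A) x
        obtain ⟨b, e, he, rfl⟩ := IsFractionRing.div_surjective (A := A) y
        have hd' := IsFractionRing.to_map_ne_zero_of_mem_nonZeroDivisors (K := k) hd
        have he' := IsFractionRing.to_map_ne_zero_of_mem_nonZeroDivisors (K := k) he
        refine ⟨a * e, b * d, d * e, ?_, ?_⟩ <;> simp <;> field_simp
      obtain ⟨s, hs, ⟨c, hc⟩ | ⟨c, hc⟩⟩ := h m hmp a b
      · refine ⟨s, hs, .inl ⟨c, ?_⟩⟩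
        rw [Algebra.smul_def, Algebra.smul_def, ← mul_div_assoc, ← map_mul, hc, map_mul]
        ring
      · refine ⟨s, hs, .inr ⟨c, ?_⟩⟩
        rw [Algebra.smul_def, Algebra.smul_def, ← mul_div_assoc, ← map_mul, hc, map_mul]
        ring) t
    (by
      rw [Finset.nonempty_iff_ne_empty]
      rintro rfl
      simp [hIdef] at hI0)
  have hs0 : s ≠ 0 := by rintro rfl; exact hs m.zero_mem
  have hx0 : x ≠ 0 := by
    rintro rfl
    apply hI0
    rw [hIdef, Submodule.span_eq_bot]
    intro y hy
    obtain ⟨c, hc⟩ := hc y hy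
    simpa [hs0] using hc
  have hxI : algebraMap A k s / x ∈ 1 / I := by
    rw [Submodule.mem_div_iff_forall_mul_mem]
    intro y hy
    suffices I ≤ (1 : Submodule A k).comap
        (LinearMap.mulLeft A (algebraMap A k s / x)) from this hy
    rw [hIdef, Submodule.span_le]
    intro y hy
    obtain ⟨c, hc⟩ := hc y hy
    simp only [SetLike.mem_coe, Submodule.mem_comap, LinearMap.mulLeft_apply, Submodule.mem_one]
    refine ⟨c, ?_⟩
    rw [Algebra.smul_def, Algebra.smul_def] at hc
    rw [div_mul_eq_mul_div, hc]
    field_simp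
  have : algebraMap A k s ∈ I * (1 / I) := by
    have := Submodule.mul_mem_mul (Submodule.subset_span hx : x ∈ I) hxI
    rwa [mul_div_cancel₀ _ hx0] at this
  exact hs (hJm this)

theorem IsLocallyDvdTotal.fg_inf_ker {A k M : Type*} [CommRing A] [IsDomain A] [Field k]
    [Algebra A k] [IsFractionRing A k] [AddCommGroup M] [Module A M] (h : IsLocallyDvdTotal A)
    {N : Submodule A M} (hN : N.FG) (φ : M →ₗ[A] k) : (N ⊓ LinearMap.ker φ).FG := by
  have : Module.Finite A N := Module.Finite.iff_fg.2 hN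
  let ψ := (φ.domRestrict N).rangeRestrict
  have := h.projective_of_fg (I := LinearMap.range (φ.domRestrict N))
    (Module.Finite.iff_fg.1 inferInstance)
  have := Module.finitePresentation_of_projective A (LinearMap.range (φ.domRestrict N))
  have := (Module.FinitePresentation.fg_ker ψ (LinearMap.surjective_rangeRestrict _)).map N.subtype
  convert this
  ext x
  simp [ψ, and_comm]

/-- The kernel of a linear map from a finite module to a torsion-free divisible module is
finitely generated. -/
theorem IsLocallyDvdTotal.fg_ker {A k M Q : Type*} [CommRing A] [IsDomain A] [Field k]
    [Algebra A k] [IsFractionRing A k] [AddCommGroup M] [Module A M] [Module.Finite A M]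
    [AddCommGroup Q] [Module A Q] [Module k Q] [IsScalarTower A k Q]
    (h : IsLocallyDvdTotal A) (φ : M →ₗ[A] Q) : (LinearMap.ker φ).FG := by
  obtain ⟨t, ht⟩ := Module.Finite.fg_top (R := A) (M := M)
  let T : Submodule k Q := Submodule.span k (φ '' t)
  have hT : ∀ x, φ x ∈ T := by
    suffices (⊤ : Submodule A M) ≤ (T.restrictScalars A).comap φ from
      fun x ↦ this Submodule.mem_top
    rw [← ht, Submodule.span_le]
    exact fun x hx ↦ Submodule.subset_span ⟨x, hx, rfl⟩
  have : FiniteDimensional k T := FiniteDimensional.span_of_finite k (t.finite_toSet.image _)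
  let b := Module.finBasis k T
  let φ' : M →ₗ[A] T := φ.codRestrict (T.restrictScalars A) hT
  have hker : LinearMap.ker φ =
      ⨅ i ∈ Finset.univ, LinearMap.ker ((b.coord i).restrictScalars A ∘ₗ φ') := by
    ext x
    have : φ x = 0 ↔ φ' x = 0 := (Subtype.ext_iff (a1 := φ' x) (a2 := 0)).symm
    rw [LinearMap.mem_ker, this, ← b.forall_coord_eq_zero_iff]
    simp only [Submodule.mem_iInf, Finset.mem_univ, forall_true_left, LinearMap.mem_ker]
    rfl
  rw [hker]
  induction (Finset.univ : Finset (Fin (Module.finrank k T))) using Finset.induction_on with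
  | empty => simpa using Module.Finite.fg_top
  | insert i s hi ih =>
    rw [Finset.iInf_insert, inf_comm]
    exact h.fg_inf_ker ih _

/-- If `M` is a finite `A`-subalgebra of a field extension of `l` whose fraction field contains `l`,
then the integral closure of `A` in `l` is finite. -/
theorem IsLocallyDvdTotal.finite_integralClosure {A k l F : Type*} [CommRing A] [IsDomain A]
    [Field k] [Algebra A k] [IsFractionRing A k] [Field l] [Algebra A l] [Algebra k l]
    [IsScalarTower A k l] [Field F] [Algebra A F] [Algebra k F] [Algebra l F]
    [IsScalarTower A k F] [IsScalarTower k l F] (h : IsLocallyDvdTotal A)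
    (M : Subalgebra A F) [Module.Finite A M] (hM : IsLocallyDvdTotal M)
    (G : Set l) (hG : Submodule.span k G = ⊤)
    (hGM : ∀ x ∈ G, ∃ s ∈ M, s ≠ 0 ∧ s * algebraMap l F x ∈ M) :
    Module.Finite A (integralClosure A l) := by
  have : IsScalarTower A l F := .of_algebraMap_eq fun a ↦ by
    rw [IsScalarTower.algebraMap_apply A k F, IsScalarTower.algebraMap_apply A k l,
      ← IsScalarTower.algebraMap_apply k l F]
  have hlM : ∀ x : l, ∃ s ∈ M, s ≠ 0 ∧ s * algebraMap l F x ∈ M := by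
    intro x
    have hx : x ∈ Submodule.span k G := hG ▸ Submodule.mem_top
    induction hx using Submodule.span_induction with
    | mem x hx => exact hGM x hx
    | zero => exact ⟨1, M.one_mem, one_ne_zero, by simp⟩
    | add x y _ _ hx hy =>
      obtain ⟨s, hs, hs0, hsx⟩ := hx
      obtain ⟨t, ht, ht0, hty⟩ := hy
      refine ⟨s * t, M.mul_mem hs ht, mul_ne_zero hs0 ht0, ?_⟩
      convert M.add_mem (M.mul_mem ht hsx) (M.mul_mem hs hty) using 1
      rw [map_add]
      ring
    | smul c x _ hx =>
      obtain ⟨s, hs, hs0, hsx⟩ := hx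
      obtain ⟨a, d, hd, rfl⟩ := IsFractionRing.div_surjective (A := A) c
      have hd' := IsFractionRing.to_map_ne_zero_of_mem_nonZeroDivisors (K := k) hd
      have hd'' : algebraMap A F d ≠ 0 := by
        rw [IsScalarTower.algebraMap_apply A k F]
        simpa using hd'
      refine ⟨algebraMap A F d * s, M.mul_mem (M.algebraMap_mem d) hs, mul_ne_zero hd'' hs0, ?_⟩
      convert M.mul_mem (M.algebraMap_mem a) hsx using 1
      rw [Algebra.smul_def, map_mul, ← IsScalarTower.algebraMap_apply k l F, map_div₀,
        ← IsScalarTower.algebraMap_apply A k F, ← IsScalarTower.algebraMap_apply A k F]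
      field_simp
  let j : l →ₐ[A] F := IsScalarTower.toAlgHom A l F
  let R : Submodule l F := LinearMap.range (Algebra.linearMap l F)
  let φ : M →ₗ[A] F ⧸ R := (R.mkQ.restrictScalars A) ∘ₗ M.val.toLinearMap
  have hker := (h.fg_ker (k := k) φ).map M.val.toLinearMap
  suffices (Subalgebra.toSubmodule (integralClosure A l)).FG from Module.Finite.iff_fg.2 this
  refine Submodule.fg_of_fg_map_injective j.toLinearMap j.injective ?_
  convert hker
  ext z
  have hφ : ∀ m : M, φ m = 0 ↔ ∃ x : l, algebraMap l F x = m := by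
    intro m
    simp [φ, R]
  simp only [Submodule.mem_map, LinearMap.mem_ker, hφ, Subalgebra.mem_toSubmodule]
  constructor
  · rintro ⟨x, hx, rfl⟩
    obtain ⟨s, hs, hs0, hsx⟩ := hlM x
    obtain ⟨m, hm⟩ := hM.isIntegral_mem_range (x := algebraMap l F x)
      (a := ⟨_, hsx⟩) (b := ⟨s, hs⟩) ((IsIntegral.map j hx).tower_top) hs0 rfl
    exact ⟨m, ⟨x, hm.symm⟩, hm⟩
  · rintro ⟨m, ⟨x, hx⟩, rfl⟩
    refine ⟨x, ?_, hx⟩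
    have hm : IsIntegral A (j x) := by
      change IsIntegral A (algebraMap l F x)
      rw [hx]
      exact (Algebra.IsIntegral.isIntegral (R := A) m).map M.val
    exact (isIntegral_algHom_iff j j.injective).1 hm

theorem ValuationSubring.isAlgClosed_residueField {Ω : Type*} [Field Ω] [IsAlgClosed Ω]
    (V : ValuationSubring Ω) : IsAlgClosed (IsLocalRing.ResidueField V) := by
  refine IsAlgClosed.of_exists_root _ fun p hp hirr ↦ ?_
  obtain ⟨q, rfl, hdeg, hq⟩ := lifts_and_natDegree_eq_and_monic
    ((mem_lifts p).2 (map_surjective _ IsLocalRing.residue_surjective p)) hp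
  obtain ⟨y, hy⟩ := IsAlgClosed.exists_aeval_eq_zero Ω q (by
    rw [degree_eq_natDegree hq.ne_zero, hdeg]
    exact_mod_cast hirr.natDegree_pos.ne')
  obtain ⟨y, rfl⟩ := IsIntegrallyClosed.isIntegral_iff.1 (⟨q, hq, hy⟩ : IsIntegral V y)
  refine ⟨IsLocalRing.residue V y, ?_⟩
  rw [aeval_algebraMap_apply, FaithfulSMul.algebraMap_eq_zero_iff] at hy
  rw [eval_map, eval₂_hom, ← coe_aeval_eq_eval, hy, map_zero]

theorem IsN2.finite_integralClosure {D L : Type u} {K : Type*} [CommRing D] [IsDomain D]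
    (h : IsN2 D) [Field K] [Algebra D K] [IsFractionRing D K] [Field L] [Algebra D L] [Algebra K L]
    [IsScalarTower D K L] [FiniteDimensional K L] : Module.Finite D (integralClosure D L) := by
  let e : FractionRing D ≃ₐ[D] K := FractionRing.algEquiv D K
  let _ : Algebra (FractionRing D) L := ((algebraMap K L).comp e.toRingHom).toAlgebra
  have : IsScalarTower D (FractionRing D) L := .of_algebraMap_eq fun x ↦ by
    change _ = algebraMap K L (e (algebraMap _ _ x))
    rw [e.commutes, ← IsScalarTower.algebraMap_apply]
  refine h L (Module.Finite.of_equiv_equiv (A₁ := K) (B₁ := L) e.symm.toRingEquiv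
    (RingEquiv.refl L) (RingHom.ext fun x ↦ ?_))
  change algebraMap K L (e (e.symm x)) = algebraMap K L x
  rw [e.apply_symm_apply]

theorem IsN2.of_isLocalization {D S : Type u} [CommRing D] [IsDomain D] [CommRing S] [IsDomain S]
    [Algebra D S] (M : Submonoid D) (hM : M ≤ nonZeroDivisors D) [IsLocalization M S]
    (h : IsN2 D) : IsN2 S := by
  intro L _ _ _ _ hL
  have : FaithfulSMul D S := (faithfulSMul_iff_algebraMap_injective D S).2
    (IsLocalization.injective S hM)
  have : FaithfulSMul D (FractionRing S) := .trans D S (FractionRing S)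
  have : IsFractionRing D (FractionRing S) := by
    refine IsFractionRing.of_field D _ fun z ↦ ?_
    obtain ⟨a, b, hb, rfl⟩ := IsFractionRing.div_surjective (A := S) z
    obtain ⟨⟨a', s⟩, ha⟩ := IsLocalization.surj M a
    obtain ⟨⟨b', t⟩, hb'⟩ := IsLocalization.surj M b
    have hs : algebraMap D (FractionRing S) s ≠ 0 := by simpa using nonZeroDivisors.ne_zero (hM s.2)
    have ht : algebraMap D (FractionRing S) t ≠ 0 := by simpa using nonZeroDivisors.ne_zero (hM t.2)
    have hb0 := IsFractionRing.to_map_ne_zero_of_mem_nonZeroDivisors (K := FractionRing S) hb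
    have ha := congrArg (algebraMap S (FractionRing S)) ha
    have hb' := congrArg (algebraMap S (FractionRing S)) hb'
    simp only [map_mul, ← IsScalarTower.algebraMap_apply D S (FractionRing S)] at ha hb'
    refine ⟨a' * t, b' * s, ?_⟩
    rw [map_mul, map_mul, ← ha, ← hb']
    field_simp
  let _ : Algebra D L := ((algebraMap S L).comp (algebraMap D S)).toAlgebra
  have : IsScalarTower D S L := .of_algebraMap_eq fun _ ↦ rfl
  have : IsScalarTower D (FractionRing S) L := .of_algebraMap_eq fun x ↦ by
    rw [IsScalarTower.algebraMap_apply D S L, IsScalarTower.algebraMap_apply S (FractionRing S) L,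
      ← IsScalarTower.algebraMap_apply D S]
  have hfin : (Subalgebra.toSubmodule (integralClosure D L)).FG :=
    Module.Finite.iff_fg.1 (h.finite_integralClosure (K := FractionRing S))
  suffices (Subalgebra.toSubmodule (integralClosure S L)).FG from Module.Finite.iff_fg.2 this
  obtain ⟨t, ht⟩ := hfin
  refine ⟨t, le_antisymm ?_ ?_⟩
  · rw [Submodule.span_le]
    intro x hx
    have : x ∈ Subalgebra.toSubmodule (integralClosure D L) := ht ▸ Submodule.subset_span hx
    exact IsIntegral.tower_top (R := D) this
  · intro x hx
    obtain ⟨m, hm⟩ := IsIntegral.exists_multiple_integral_of_isLocalization M x hx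
    have hm' : m • x ∈ Submodule.span D (t : Set L) := ht ▸ hm
    have hm'' := Submodule.span_le_restrictScalars D S (t : Set L) hm'
    obtain ⟨u, hu⟩ := IsLocalization.map_units S m
    have : x = (↑u⁻¹ : S) • (m • x) := by
      rw [Submonoid.smul_def, ← algebraMap_smul S (m : D) x, ← hu, smul_smul, u.inv_mul, one_smul]
    rw [this]
    exact Submodule.smul_mem _ _ hm''

theorem IsN2.quotient {D : Type u} [CommRing D] [IsDomain D] (h : IsN2 D)
    (hD : IsLocallyDvdTotal D) (p : Ideal D) [p.IsPrime] : IsN2 (D ⧸ p) := by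
  intro l _ _ _ _ hl
  let K := FractionRing D
  let Ω := AlgebraicClosure K
  have : FaithfulSMul D Ω := .trans D K Ω
  have hinj : Function.Injective (algebraMap D Ω) := FaithfulSMul.algebraMap_injective D Ω
  have hunit : ∀ y : p.primeCompl, IsUnit (algebraMap D Ω y) := fun y ↦ by
    rw [isUnit_iff_ne_zero, Ne, map_eq_zero_iff _ hinj]
    intro hy
    exact y.2 (hy ▸ p.zero_mem)
  obtain ⟨V, hV, hloc⟩ := IsLocalRing.exists_factor_valuationRing
    (IsLocalization.lift (S := Localization.AtPrime p) hunit)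
  let F := IsLocalRing.ResidueField V
  let v : D →+* V := (RingHom.codRestrict _ V.toSubring hV).comp (algebraMap D _)
  have hv : ∀ d, (v d : Ω) = algebraMap D Ω d := fun d ↦ IsLocalization.lift_eq hunit d
  let f : D →+* F := (IsLocalRing.residue V).comp v
  have hf : ∀ d, f d = 0 ↔ d ∈ p := by
    intro d
    rw [← not_iff_not]
    change IsLocalRing.residue V _ ≠ 0 ↔ _
    rw [IsLocalRing.residue_ne_zero_iff_isUnit]
    change IsUnit (RingHom.codRestrict _ V.toSubring hV
      (algebraMap D (Localization.AtPrime p) d)) ↔ _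
    rw [isUnit_map_iff, IsLocalization.AtPrime.isUnit_to_map_iff (Localization.AtPrime p) p]
    rfl
  have := V.isAlgClosed_residueField
  let g : D ⧸ p →+* F := Ideal.Quotient.lift p f fun d hd ↦ (hf d).2 hd
  have hg : Function.Injective g := (injective_iff_map_eq_zero g).2 fun a ha ↦ by
    obtain ⟨d, rfl⟩ := Ideal.Quotient.mk_surjective a
    exact Ideal.Quotient.eq_zero_iff_mem.2 ((hf d).1 ha)
  let _ : Algebra D F := f.toAlgebra
  let _ : Algebra (D ⧸ p) F := g.toAlgebra
  let _ : Algebra (FractionRing (D ⧸ p)) F := (IsFractionRing.lift hg).toAlgebra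
  have : IsScalarTower D (D ⧸ p) F := .of_algebraMap_eq fun _ ↦ rfl
  have : IsScalarTower (D ⧸ p) (FractionRing (D ⧸ p)) F :=
    .of_algebraMap_eq fun x ↦ (IsFractionRing.lift_algebraMap hg x).symm
  let _ : Algebra l F := (IsAlgClosed.lift (R := FractionRing (D ⧸ p)) (M := F)
    (S := l)).toRingHom.toAlgebra
  have : IsScalarTower (FractionRing (D ⧸ p)) l F := .of_algebraMap_eq fun x ↦
    ((IsAlgClosed.lift (R := FractionRing (D ⧸ p)) (M := F) (S := l)).commutes x).symm
  let b := Module.finBasis (FractionRing (D ⧸ p)) l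
  choose y hy using fun i ↦ IsLocalRing.residue_surjective (R := V) (algebraMap l F (b i))
  let L : IntermediateField K Ω := IntermediateField.adjoin K (Set.range fun i ↦ (y i : Ω))
  have : FiniteDimensional K L := IntermediateField.finiteDimensional_adjoin fun x _ ↦
    Algebra.IsIntegral.isIntegral x
  have hB : Module.Finite D (integralClosure D L) := h.finite_integralClosure (K := K)
  have : Algebra.IsAlgebraic D L := (IsFractionRing.comap_isAlgebraic_iff (K := K)).2 inferInstance
  have : FaithfulSMul D L := .trans D K L
  have hBL := hD.integralClosure_of_isAlgebraic (L := L)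
  have hBV : ∀ x : integralClosure D L, ((x : L) : Ω) ∈ V := by
    intro x
    obtain ⟨q, hq, hqx⟩ := (x.2 : IsIntegral D (x : L)).map (L.val.restrictScalars D)
    have : IsIntegral V ((x : L) : Ω) := by
      refine ⟨q.map v, hq.map v, ?_⟩
      rw [eval₂_map, show (algebraMap V Ω).comp v = algebraMap D Ω from RingHom.ext hv]
      exact hqx
    obtain ⟨z, hz⟩ := IsIntegrallyClosed.isIntegral_iff.1 this
    exact hz ▸ z.2
  let w : integralClosure D L →+* V := RingHom.codRestrict
    (L.val.toRingHom.comp (integralClosure D L).val.toRingHom) V.toSubring hBV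
  have hw : ∀ x, (w x : Ω) = (x : L) := fun _ ↦ rfl
  let ρ : integralClosure D L →ₐ[D] F :=
    { (IsLocalRing.residue V).comp w with
      commutes' := fun d ↦ by
        change IsLocalRing.residue V (w _) = IsLocalRing.residue V (v d)
        congr 1
        exact Subtype.ext (hv d).symm }
  let M : Subalgebra (D ⧸ p) F :=
    { ρ.range with
      algebraMap_mem' := fun a ↦ by
        obtain ⟨d, rfl⟩ := Ideal.Quotient.mk_surjective a
        exact ρ.range.algebraMap_mem d }
  let ρ' : integralClosure D L →ₗ[D] M :=
    { toFun := fun x ↦ ⟨ρ x, x, rfl⟩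
      map_add' := fun x y ↦ Subtype.ext (map_add ρ x y)
      map_smul' := fun d x ↦ Subtype.ext (map_smul ρ d x) }
  have hρ' : Function.Surjective ρ' := by
    rintro ⟨_, x, rfl⟩
    exact ⟨x, rfl⟩
  have : Module.Finite D M := Module.Finite.of_surjective ρ' hρ'
  have : Module.Finite (D ⧸ p) M := Module.Finite.of_restrictScalars_finite D _ _
  have hM : IsLocallyDvdTotal M := hBL.of_surjective
    (ρ.toRingHom.codRestrict M.toSubsemiring fun x ↦ ⟨x, rfl⟩) hρ'
  refine (hD.of_surjective _ Ideal.Quotient.mk_surjective).finite_integralClosure M hM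
    (Set.range b) b.span_eq ?_
  rintro _ ⟨i, rfl⟩
  rw [← hy i]
  have hyL : (y i : Ω) ∈ L := IntermediateField.subset_adjoin _ _ ⟨i, rfl⟩
  obtain ⟨d, hd, hdy⟩ := (Algebra.IsAlgebraic.isAlgebraic (R := D)
    (⟨y i, hyL⟩ : L)).exists_integral_multiple
  let P : Ideal (integralClosure D L) := RingHom.ker ρ
  obtain ⟨s, hs, hst⟩ := hBL P (RingHom.ker_isPrime ρ) ⟨_, hdy⟩ (algebraMap D _ d)
  have hdΩ : algebraMap D Ω d ≠ 0 := by simpa using hd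
  rcases hst with ⟨t, ht⟩ | ⟨t, ht⟩
  · have hsy : w s * y i = w t := by
      have := congrArg (fun x : integralClosure D L ↦ ((x : L) : Ω)) ht
      change ((s : L) : Ω) * (d • (y i : Ω)) = algebraMap D Ω d * (t : L) at this
      refine Subtype.ext (mul_left_cancel₀ hdΩ ?_)
      rw [← hw t] at this
      rw [← this, Algebra.smul_def]
      change algebraMap D Ω d * ((s : L) * (y i : Ω)) = _
      ring
    refine ⟨ρ s, ⟨s, rfl⟩, hs, t, ?_⟩
    change IsLocalRing.residue V (w t) = IsLocalRing.residue V (w s) * _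
    rw [← hsy, map_mul]
  · have hsy : w s = w t * y i := by
      have := congrArg (fun x : integralClosure D L ↦ ((x : L) : Ω)) ht
      change ((s : L) : Ω) * algebraMap D Ω d = (d • (y i : Ω)) * (t : L) at this
      refine Subtype.ext (mul_left_cancel₀ hdΩ ?_)
      rw [Algebra.smul_def] at this
      rw [hw s, mul_comm, this]
      change _ = algebraMap D Ω d * ((t : L) * (y i : Ω))
      ring
    have hρ : ρ s = ρ t * IsLocalRing.residue V (y i) := by
      change IsLocalRing.residue V (w s) = IsLocalRing.residue V (w t) * _
      rw [hsy, map_mul]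
    refine ⟨ρ t, ⟨t, rfl⟩, ?_, s, hρ⟩
    intro h0
    exact hs (by rw [h0, zero_mul] at hρ; exact hρ)

/-- If a Prüfer domain `D` is N-2, then for every prime ideal `𝔭` both the
localization `D_𝔭` and the quotient domain `D/𝔭` are N-2. -/
theorem isN2_localization_and_quotient_of_prufer_isN2
    (D : Type u) [CommRing D] [IsDomain D] (hD : IsPruferDomain D)
    (hN2 : IsN2 D) (𝔭 : Ideal D) [𝔭.IsPrime] :
    IsN2 (Localization.AtPrime 𝔭) ∧ IsN2 (D ⧸ 𝔭) := by
  exact ⟨hN2.of_isLocalization 𝔭.primeCompl 𝔭.primeCompl_le_nonZeroDivisors,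
    hN2.quotient hD.isLocallyDvdTotal 𝔭⟩
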